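/- Let G be a simple graph with a proper 2-coloring c, and let u ≠ v be two vertices that are connected in G and satisfy c(u) = c(v). Then the graph G' obtained from G by adding the edge {u,v} admits no proper 2-coloring (inserting an edge between two same-colored vertices of one connected component of a bipartite graph destroys bipartiteness). -/

import Mathlib

/-- Two proper 2-colorings agree on whether two connected vertices have the same color. -/
theorem SimpleGraph.Reachable.bool_coloring_eq_iff {V : Type*} {G : SimpleGraph V} {u v : V}
    (h : G.Reachable u v) (C D : G.Coloring Bool) : C u = C v ↔ D u = D v := by
  obtain ⟨p⟩ := h
  exact Bool.eq_iff_iff.trans ((C.even_length_iff_congr p).symm.trans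
    ((D.even_length_iff_congr p).trans Bool.eq_iff_iff.symm))

/-- Inserting an edge between two same-colored vertices of one connected component of a
bipartite graph destroys bipartiteness. -/
theorem insert_same_color_connected_not_bipartite {V : Type*} (G : SimpleGraph V)
    (c : V → Bool) (hc : ∀ x y, G.Adj x y → c x ≠ c y)
    (u v : V) (huv : u ≠ v) (hconn : G.Reachable u v) (hcol : c u = c v) :
    ¬ ∃ c' : V → Bool, ∀ x y, (G ⊔ SimpleGraph.edge u v).Adj x y → c' x ≠ c' y := by
  rintro ⟨c', hc'⟩
  let C : G.Coloring Bool := SimpleGraph.Coloring.mk c fun {x y} h => hc x y h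
  let D : G.Coloring Bool := SimpleGraph.Coloring.mk c' fun {x y} h => hc' x y (Or.inl h)
  have hadj : (G ⊔ SimpleGraph.edge u v).Adj u v :=
    Or.inr ((SimpleGraph.edge_adj u v u v).mpr ⟨Or.inl ⟨rfl, rfl⟩, huv⟩)
  exact hc' u v hadj ((hconn.bool_coloring_eq_iff C D).mp hcol)
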